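/- In the quasi-staircase subshift: if w ∈ W_n, then exactly one of the following holds: (i) w is a suffix of 1^{c_n+i−1}(B_n 1^{c_n+i})^{a_n} with |w| > c_n + i, for some 0 ≤ i < b_n; (ii) w is a suffix of 1^{c_n+b_n−1} B_n 1^{c_n} with |w| > h_n + 2c_n; or (iii) w = 1^{c_n}(B_n 1^{c_n})^{a_n}. -/

import Mathlib

open Filter MeasureTheory
open scoped ENNReal

/-- `n`-fold concatenation (power) of a word. -/
def wpow {α : Type*} (v : List α) (n : ℕ) : List α := (List.replicate n v).flatten

/-- The word `1^k` over the alphabet `{0,1}` (with `0 = false`, `1 = true`). -/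
def ones (k : ℕ) : List Bool := List.replicate k true

/-- The left shift on biinfinite sequences. -/
def shift {A : Type*} (x : ℤ → A) : ℤ → A := fun n => x (n + 1)

/-- The word `x_{[s, s+len)}` read off a biinfinite sequence. -/
def readWord {A : Type*} (x : ℤ → A) (s : ℤ) (len : ℕ) : List A :=
  (List.range len).map (fun i => x (s + (i : ℤ)))

/-- A finite word occurs (as a consecutive subword) in a biinfinite sequence. -/
def occursIn {A : Type*} (w : List A) (x : ℤ → A) : Prop :=
  ∃ k : ℤ, readWord x k w.length = w

/-- The quasi-staircase words: `B 1 = 0` and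
`B (n+1) = (∏_{i=0}^{b n - 1} (B n · 1^{c n + i})^{a n}) · B n`. -/
def qsB (a b c : ℕ → ℕ) : ℕ → List Bool
  | 0 => []
  | 1 => [false]
  | (n+2) =>
      ((List.range (b (n+1))).map
        (fun i => wpow (qsB a b c (n+1) ++ ones (c (n+1) + i)) (a (n+1)))).flatten
        ++ qsB a b c (n+1)

/-- The language of the quasi-staircase subshift: all subwords of some `B n`, `n ≥ 1`. -/
def qsL (a b c : ℕ → ℕ) : Set (List Bool) :=
  {w | ∃ n, 1 ≤ n ∧ w <:+: qsB a b c n}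

/-- The quasi-staircase subshift: biinfinite sequences all of whose finite subwords
lie in the language. -/
def qsX (a b c : ℕ → ℕ) : Set (ℤ → Bool) :=
  {x | ∀ w : List Bool, occursIn w x → w ∈ qsL a b c}

/-- Right-special words of the quasi-staircase subshift: `w`, `w0` and `w1` all lie
in the language. -/
def RS (a b c : ℕ → ℕ) (w : List Bool) : Prop :=
  w ∈ qsL a b c ∧ (w ++ [false]) ∈ qsL a b c ∧ (w ++ [true]) ∈ qsL a b c

/-- The tail length `z(w)`: the number of `1`s at the end of `w`. -/
def ztail (w : List Bool) : ℕ := (w.reverse.takeWhile id).length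

/-- The level-`n` generating words: right-special words containing a `0` whose tail
length lies in `[c n, c (n+1))`. -/
def Wn (a b c : ℕ → ℕ) (n : ℕ) : Set (List Bool) :=
  {w | RS a b c w ∧ false ∈ w ∧ c n ≤ ztail w ∧ ztail w < c (n+1)}

/-- The word complexity of the quasi-staircase subshift. -/
noncomputable def cplx (a b c : ℕ → ℕ) (q : ℕ) : ℕ :=
  Set.ncard {w | w ∈ qsL a b c ∧ w.length = q}

/-- The level-`n` complexity functions. -/
noncomputable def cplxn (a b c : ℕ → ℕ) (n q : ℕ) : ℕ :=
  Set.ncard {w | w ∈ Wn a b c n ∧ w.length < q}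

/-- The height sequence of the quasi-staircase: `h n = |B n|`. -/
def qsh (a b c : ℕ → ℕ) : ℕ → ℕ
  | 0 => 0
  | 1 => 1
  | (n+2) => (a (n+1) * b (n+1) + 1) * qsh a b c (n+1)
      + a (n+1) * b (n+1) * c (n+1) + a (n+1) * b (n+1) * (b (n+1) - 1) / 2

/-- The post-productive sequence `m n = a n * h n + (a n + 1) * (c n + b n - 1)`. -/
def qsm (a b c : ℕ → ℕ) (n : ℕ) : ℕ :=
  a n * qsh a b c n + (a n + 1) * (c n + b n - 1)

/-- The standing quasi-staircase hypotheses: `a`, `b`, `c` are nondecreasing sequences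
of positive integers (for `n ≥ 1`) tending to infinity, with `c 1 ≥ 1` and
`c (n+1) ≥ c n + b n` for all `n ≥ 1`. -/
def QShyp (a b c : ℕ → ℕ) : Prop :=
  (∀ n, 1 ≤ n → 1 ≤ a n ∧ a n ≤ a (n+1)) ∧ Tendsto a atTop atTop ∧
  (∀ n, 1 ≤ n → 1 ≤ b n ∧ b n ≤ b (n+1)) ∧ Tendsto b atTop atTop ∧
  (∀ n, 1 ≤ n → 1 ≤ c n ∧ c n ≤ c (n+1)) ∧ Tendsto c atTop atTop ∧
  (∀ n, 1 ≤ n → c n + b n ≤ c (n+1))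

/-- Form (i): `w` is a suffix of `1^{c n + i - 1} (B n 1^{c n + i})^{a n}` with
`|w| > c n + i`, for some `0 ≤ i < b n`. -/
def qsForm1 (a b c : ℕ → ℕ) (n : ℕ) (w : List Bool) : Prop :=
  ∃ i, i < b n ∧
    w <:+ ones (c n + i - 1) ++ wpow (qsB a b c n ++ ones (c n + i)) (a n) ∧
    c n + i < w.length

/-- Form (ii): `w` is a suffix of `1^{c n + b n - 1} B n 1^{c n}` with
`|w| > h n + 2 c n`. -/
def qsForm2 (a b c : ℕ → ℕ) (n : ℕ) (w : List Bool) : Prop :=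
  w <:+ ones (c n + b n - 1) ++ qsB a b c n ++ ones (c n) ∧
    qsh a b c n + 2 * c n < w.length

/-- Form (iii): `w = 1^{c n} (B n 1^{c n})^{a n}`. -/
def qsForm3 (a b c : ℕ → ℕ) (n : ℕ) (w : List Bool) : Prop :=
  w = ones (c n) ++ wpow (qsB a b c n ++ ones (c n)) (a n)


def qenc (B : List Bool) (S : List ℕ) : List Bool := (S.map (fun s => B ++ ones s)).flatten

def qstuff (a c : ℕ) (m : ℕ) : List ℕ :=
  ((List.range m).map (fun i => List.replicate a (c + i))).flatten

def qexp (σ T : List ℕ) : List ℕ := (T.map (fun t => σ ++ [t])).flatten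

def qNoRun (B : List Bool) (C : ℕ) : Prop :=
  ∀ p q z, B = p ++ [false] ++ ones z ++ q → z < C

theorem qenc_nil (B) : qenc B [] = [] := rfl
theorem qenc_cons (B s S) : qenc B (s :: S) = B ++ ones s ++ qenc B S := by simp [qenc]
theorem qenc_append (B S T) : qenc B (S ++ T) = qenc B S ++ qenc B T := by simp [qenc]
theorem qexp_nil (σ) : qexp σ [] = [] := rfl
theorem qexp_cons (σ s S) : qexp σ (s :: S) = σ ++ s :: qexp σ S := by simp [qexp]
theorem qexp_append (σ S T) : qexp σ (S ++ T) = qexp σ S ++ qexp σ T := by simp [qexp]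
theorem wpow_eq (B s k) : wpow (B ++ ones s) k = qenc B (List.replicate k s) := by
  simp [wpow, qenc]
theorem qstuff_succ (a c m) : qstuff a c (m+1) = qstuff a c m ++ List.replicate a (c+m) := by
  simp [qstuff, List.range_succ]
theorem wpow_succ' {α : Type*} (v : List α) (k : ℕ) : wpow v (k+1) = v ++ wpow v k := by
  simp [wpow, List.replicate_succ]
theorem wpow_add {α : Type*} (v : List α) (k l : ℕ) : wpow v (k+l) = wpow v k ++ wpow v l := by
  rw [wpow, List.replicate_add]; simp [wpow, -List.replicate_append_replicate]
theorem ones_add (k l) : ones (k+l) = ones k ++ ones l := by simp [ones]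
theorem ones_succ (k) : ones (k+1) = true :: ones k := by simp [ones, List.replicate_succ]
theorem ones_len (k) : (ones k).length = k := by simp [ones]

theorem qsB_succ (a b c : ℕ → ℕ) (n : ℕ) (hn : 1 ≤ n) :
    qsB a b c (n+1) = qenc (qsB a b c n) (qstuff (a n) (c n) (b n)) ++ qsB a b c n := by
  obtain ⟨m, rfl⟩ : ∃ m, n = m + 1 := ⟨n - 1, by omega⟩
  rw [qsB]
  congr 1
  simp only [wpow_eq]
  generalize b (m+1) = k
  induction k with
  | zero => simp [qstuff, qenc]
  | succ k ih => rw [List.range_succ, qstuff_succ, qenc_append, ← ih]; simp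

theorem qenc_qenc (B σ T) : qenc (qenc B σ ++ B) T ++ (qenc B σ ++ B)
    = qenc B (qexp σ T ++ σ) ++ B := by
  induction T with
  | nil => simp [qenc_nil, qexp_nil]
  | cons t T ih =>
    rw [qenc_cons, qexp_cons]
    simp only [List.append_assoc, List.cons_append] at ih ⊢
    rw [ih, qenc_append B σ, qenc_cons]; simp

theorem qstuff_split (a c : ℕ) (b : ℕ) (S1 : List ℕ) (s : ℕ) (S2 : List ℕ)
    (h : qstuff a c b = S1 ++ s :: S2) :
    ∃ j m, j < b ∧ m < a ∧ s = c + j ∧ S1 = qstuff a c j ++ List.replicate m (c+j) := by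
  induction b generalizing S2 with
  | zero => simp [qstuff] at h
  | succ b ih =>
    rw [qstuff_succ, List.append_eq_append_iff] at h
    rcases h with ⟨t, h1, h2⟩ | ⟨t, h1, h2⟩
    · have h3 := h2.symm
      rw [List.append_eq_replicate_iff] at h3
      obtain ⟨h4, h5, h6⟩ := h3
      refine ⟨b, t.length, by omega, by simp at h4; omega, ?_, ?_⟩
      · simp [List.replicate_succ] at h6; exact h6.1
      · rw [h1]; congr 1
    · cases t with
      | nil =>
        simp at h1 h2
        have h3 : [] ++ s :: S2 = List.replicate a (c+b) := by simpa using h2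
        rw [List.append_eq_replicate_iff] at h3
        obtain ⟨h4, h5, h6⟩ := h3
        refine ⟨b, 0, by omega, by simp at h4; omega, ?_, ?_⟩
        · simp [List.replicate_succ] at h6; exact h6.1
        · simp [h1]
      | cons x t =>
        simp at h2
        obtain ⟨rfl, h2⟩ := h2
        obtain ⟨j, m, h3, h4⟩ := ih _ h1
        exact ⟨j, m, by omega, h4⟩

theorem mem_qstuff {a c b s : ℕ} (h : s ∈ qstuff a c b) : c ≤ s ∧ s < c + b := by
  simp [qstuff] at h
  obtain ⟨i, h1, h2, h3⟩ := h
  omega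

theorem qexp_split (σ T : List ℕ) (C : ℕ) (hT : ∀ t ∈ T, C ≤ t) (S1 : List ℕ) (s : ℕ)
    (S2 : List ℕ) (h : qexp σ T ++ σ = S1 ++ s :: S2) :
    ∃ T1 σ1, (∀ t ∈ T1, C ≤ t) ∧ S1 = qexp σ T1 ++ σ1 ∧
      ((∃ σ2, σ = σ1 ++ s :: σ2) ∨ (σ1 = σ ∧ C ≤ s)) := by
  induction T generalizing S1 with
  | nil => exact ⟨[], S1, by simp, by simp [qexp_nil], Or.inl ⟨S2, by simpa [qexp_nil] using h⟩⟩
  | cons t T ih =>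
    rw [qexp_cons, List.append_assoc, List.append_eq_append_iff] at h
    rcases h with ⟨u, h1, h2⟩ | ⟨u, h1, h2⟩
    · cases u with
      | nil =>
        simp at h1 h2
        exact ⟨[], S1, by simp, by simp [qexp_nil],
          Or.inr ⟨h1, h2.1 ▸ hT t (by simp)⟩⟩
      | cons x u =>
        simp at h2
        obtain ⟨rfl, h2⟩ := h2
        obtain ⟨T1, σ1, g1, g2, g3⟩ := ih (fun t ht => hT t (by simp [ht])) u h2
        refine ⟨t :: T1, σ1, ?_, ?_, g3⟩
        · intro y hy
          rcases List.mem_cons.1 hy with rfl | hy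
          · exact hT _ (by simp)
          · exact g1 y hy
        · rw [h1, g2, qexp_cons]; simp
    · cases u with
      | nil =>
        simp at h1 h2
        exact ⟨[], S1, by simp, by simp [qexp_nil],
          Or.inr ⟨h1.symm, h2.1 ▸ hT t (by simp)⟩⟩
      | cons x u =>
        simp at h2
        obtain ⟨rfl, h2⟩ := h2
        exact ⟨[], S1, by simp, by simp [qexp_nil], Or.inl ⟨u, h1⟩⟩

/-- Comparing runs of ones. -/
theorem ones_cmp {z s : ℕ} {q r : List Bool} (h : ones z ++ q = ones s ++ false :: r) :
    z ≤ s ∧ q = ones (s - z) ++ false :: r := by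
  induction z generalizing s with
  | zero => simpa [ones] using h
  | succ z ih =>
    cases s with
    | zero => simp [ones, List.replicate_succ] at h
    | succ s =>
      simp only [ones_succ, List.cons_append, List.cons.injEq, true_and] at h
      obtain ⟨h1, h2⟩ := ih h
      exact ⟨by omega, by simpa using h2⟩

theorem false_not_ones {k : ℕ} {l r : List Bool} (h : ones k = l ++ false :: r) : False := by
  have : false ∈ ones k := by rw [h]; simp
  simp [ones] at this

theorem qenc_run (B : List Bool) (C : ℕ) (B' B'' : List Bool) (h0 : B = false :: B')
    (h1 : B = B'' ++ [false]) (hN : qNoRun B C) (S : List ℕ) (p q : List Bool) (z : ℕ)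
    (hz : C ≤ z) (h : p ++ [false] ++ ones z ++ q = qenc B S ++ B) :
    ∃ S1 s S2, S = S1 ++ s :: S2 ∧ z ≤ s ∧ p ++ [false] = qenc B S1 ++ B ∧
      q = ones (s - z) ++ qenc B S2 ++ B := by
  induction S generalizing p with
  | nil =>
    have := hN p q z (by simpa [qenc_nil] using h.symm)
    omega
  | cons s S ih =>
    obtain ⟨R, hR⟩ : ∃ R, qenc B S ++ B = false :: R := by
      cases S with
      | nil => exact ⟨B', by simpa [qenc_nil] using h0⟩
      | cons x S => rw [qenc_cons]; exact ⟨_, by nth_rw 1 [h0]; simp; rfl⟩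
    have h' : (p ++ [false]) ++ (ones z ++ q) = B ++ (ones s ++ (qenc B S ++ B)) := by
      simpa [qenc_cons] using h
    rw [List.append_eq_append_iff] at h'
    rcases h' with ⟨t, h2, h3⟩ | ⟨t, h2, h3⟩
    · rcases List.eq_nil_or_concat t with rfl | ⟨t', x, rfl⟩
      · simp at h2
        rw [hR] at h3
        obtain ⟨h4, h5⟩ := ones_cmp (by simpa using h3)
        exact ⟨[], s, S, rfl, h4, by simp [qenc_nil, h2], by rw [h5, ← hR]; simp⟩
      · exfalso
        simp only [List.concat_eq_append] at h2 h3
        have hx : x = false := by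
          have := congrArg List.getLast? (h1.symm.trans h2)
          rw [← List.append_assoc, List.getLast?_concat, List.getLast?_concat] at this
          simpa using this.symm
        subst hx
        rw [List.append_assoc, List.append_eq_append_iff] at h3
        rcases h3 with ⟨u, h4, h5⟩ | ⟨u, h4, h5⟩
        · have := hN p (u ++ [false]) z (by rw [h2, h4]; simp)
          omega
        · cases u with
          | nil =>
            simp at h4
            have := hN p ([false]) z (by rw [h2, h4]; simp)
            omega
          | cons y u =>
            simp at h5
            rw [h5.1] at h4
            exact false_not_ones h4
    · rcases List.eq_nil_or_concat t with rfl | ⟨t', x, rfl⟩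
      · simp at h2 h3
        rw [hR] at h3
        obtain ⟨h4, h5⟩ := ones_cmp h3.symm
        exact ⟨[], s, S, rfl, h4, by simp [qenc_nil, h2], by rw [h5, ← hR]; simp⟩
      · simp only [List.concat_eq_append] at h2 h3
        have hx : x = false := by
          have := congrArg List.getLast? h2
          simpa using this.symm
        subst hx
        rw [List.append_assoc, List.append_eq_append_iff] at h3
        have key : ∃ u, t' = ones s ++ u ∧
            u ++ [false] ++ ones z ++ q = qenc B S ++ B := by
          rcases h3 with ⟨u, h4, h5⟩ | ⟨u, h4, h5⟩
          · exact ⟨u, h4, by simpa using h5.symm⟩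
          · cases u with
            | nil => exact ⟨[], by simpa using h4.symm, by simpa using h5⟩
            | cons y u =>
              simp at h5
              rw [h5.1] at h4
              exact (false_not_ones h4).elim
        obtain ⟨u, hu, h6⟩ := key
        obtain ⟨S1, s', S2, g1, g2, g3, g4⟩ := ih u h6
        refine ⟨s :: S1, s', S2, by rw [g1]; rfl, g2, ?_, g4⟩
        rw [h2, hu, qenc_cons]
        simp only [List.append_assoc] at g3 ⊢
        rw [g3]

theorem qsB_ends (a b c : ℕ → ℕ) (n : ℕ) (hn : 1 ≤ n) :
    (∃ B', qsB a b c n = false :: B') ∧ (∃ B', qsB a b c n = B' ++ [false]) := by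
  induction n, hn using Nat.le_induction with
  | base => exact ⟨⟨[], rfl⟩, ⟨[], rfl⟩⟩
  | succ n hn ih =>
    obtain ⟨⟨B1, h1⟩, ⟨B2, h2⟩⟩ := ih
    rw [qsB_succ a b c n hn]
    constructor
    · cases qstuff (a n) (c n) (b n) with
      | nil => exact ⟨B1, by simpa [qenc_nil] using h1⟩
      | cons x S => rw [qenc_cons]; exact ⟨_, by nth_rw 1 [h1]; simp; rfl⟩
    · exact ⟨_, by nth_rw 2 [h2]; rw [← List.append_assoc]⟩

theorem qsB_noRun (a b c : ℕ → ℕ) (hQ : QShyp a b c) (n : ℕ) (hn : 1 ≤ n) :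
    qNoRun (qsB a b c n) (c n) := by
  obtain ⟨ha, -, hb, -, hc, -, hcb⟩ := hQ
  induction n, hn using Nat.le_induction with
  | base =>
    intro p q z h
    have := congrArg List.length h
    simp [qsB, ones] at this
    have := (hc 1 le_rfl).1
    omega
  | succ n hn ih =>
    intro p q z h
    by_contra hz
    push Not at hz
    obtain ⟨⟨B1, h1⟩, ⟨B2, h2⟩⟩ := qsB_ends a b c n hn
    rw [qsB_succ a b c n hn] at h
    have := hcb n hn
    obtain ⟨S1, s, S2, g1, g2, -⟩ := qenc_run _ _ _ _ h1 h2 ih _ p q z (by omega) h.symm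
    have := (mem_qstuff (a := a n) (c := c n) (b := b n) (s := s) (by rw [g1]; simp)).2
    omega

theorem qsB_rep (a b c : ℕ → ℕ) (hQ : QShyp a b c) (n : ℕ) (hn : 1 ≤ n) (N : ℕ) (hN : n ≤ N) :
    c n ≤ c N ∧
    ∃ T, (∀ t ∈ T, c n ≤ t) ∧ qsB a b c N = qenc (qsB a b c n) T ++ qsB a b c n := by
  induction N, hN using Nat.le_induction with
  | base => exact ⟨le_rfl, [], by simp, by simp [qenc_nil]⟩
  | succ N hN ih =>
    obtain ⟨h0, T, hT, h⟩ := ih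
    refine ⟨h0.trans (hQ.2.2.2.2.1 N (by omega)).2,
      qexp T (qstuff (a N) (c N) (b N)) ++ T, ?_, ?_⟩
    · intro t ht
      simp only [List.mem_append, qexp, List.mem_flatten, List.mem_map] at ht
      rcases ht with ⟨l, ⟨s, hs, rfl⟩, ht⟩ | ht
      · simp at ht
        rcases ht with ht | rfl
        · exact hT t ht
        · have := mem_qstuff hs; omega
      · exact hT t ht
    · rw [qsB_succ a b c N (by omega), h, qenc_qenc]

theorem qsL_rep (a b c : ℕ → ℕ) (hQ : QShyp a b c) (n : ℕ) (hn : 1 ≤ n) (w : List Bool)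
    (hw : w ∈ qsL a b c) :
    ∃ T, (∀ t ∈ T, c (n+1) ≤ t) ∧
      w <:+: qenc (qsB a b c n) (qexp (qstuff (a n) (c n) (b n)) T ++ qstuff (a n) (c n) (b n))
        ++ qsB a b c n := by
  obtain ⟨m, hm, hw⟩ := hw
  obtain ⟨-, T, hT, h⟩ := qsB_rep a b c hQ (n+1) (by omega) (max m (n+1)) (by omega)
  obtain ⟨-, T', -, h'⟩ := qsB_rep a b c hQ m (by omega) (max m (n+1)) (by omega)
  refine ⟨T, hT, ?_⟩
  rw [← qenc_qenc, ← qsB_succ a b c n hn, ← h, h']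
  exact hw.trans (List.suffix_append _ _).isInfix

/-- Structure of the past of a run of ones `≥ c n`. -/
theorem past (a b c : ℕ → ℕ) (hQ : QShyp a b c) (n : ℕ) (hn : 1 ≤ n) (u q : List Bool) (z : ℕ)
    (hz : c n ≤ z) (hw : u ++ [false] ++ ones z ++ q ∈ qsL a b c) :
    ∃ T1 σ1 s R Q, (∀ t ∈ T1, c (n+1) ≤ t) ∧ z ≤ s ∧
      Q ++ (u ++ [false]) = qenc (qsB a b c n)
        (qexp (qstuff (a n) (c n) (b n)) T1 ++ σ1) ++ qsB a b c n ∧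
      q <+: ones (s - z) ++ false :: R ∧
      ((∃ σ2, qstuff (a n) (c n) (b n) = σ1 ++ s :: σ2) ∨
        (σ1 = qstuff (a n) (c n) (b n) ∧ c (n+1) ≤ s)) := by
  obtain ⟨T, hT, Q, Q', h⟩ := qsL_rep a b c hQ n hn _ hw
  obtain ⟨⟨B1, h1⟩, ⟨B2, h2⟩⟩ := qsB_ends a b c n hn
  obtain ⟨S1, s, S2, g1, g2, g3, g4⟩ := qenc_run _ _ _ _ h1 h2 (qsB_noRun a b c hQ n hn) _
    (Q ++ u) (q ++ Q') z hz (by rw [← h]; simp)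
  obtain ⟨T1, σ1, k1, k2, k3⟩ := qexp_split _ T _ hT S1 s S2 g1
  obtain ⟨R, hR⟩ : ∃ R, qenc (qsB a b c n) S2 ++ qsB a b c n = false :: R := by
    cases S2 with
    | nil => exact ⟨B1, by simpa [qenc_nil] using h1⟩
    | cons x S => rw [qenc_cons]; exact ⟨_, by nth_rw 1 [h1]; simp; rfl⟩
  refine ⟨T1, σ1, s, R, Q, k1, g2, ?_, ⟨Q', ?_⟩, k3⟩
  · rw [← k2, ← g3]; simp
  · rw [g4, ← hR]; simp

theorem diverge {w R Q1 Q2 : List Bool} {x y : Bool} (hxy : x ≠ y)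
    (h1 : w <:+ Q1 ++ x :: R) (h2 : w <:+ Q2 ++ y :: R) : w <:+ R := by
  by_cases hl : w.length ≤ R.length
  · exact List.suffix_of_suffix_length_le h1 ((List.suffix_cons x R).trans
      (List.suffix_append _ _)) hl
  · exfalso
    have e1 : x :: R <:+ w := List.suffix_of_suffix_length_le (List.suffix_append _ _) h1
      (by simp; omega)
    have e2 : y :: R <:+ w := List.suffix_of_suffix_length_le (List.suffix_append _ _) h2
      (by simp; omega)
    have e3 := (List.suffix_of_suffix_length_le e1 e2 (by simp)).eq_of_length (by simp)
    simp at e3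
    exact hxy e3

theorem pastA (a b c : ℕ → ℕ) (hQ : QShyp a b c) (n : ℕ) (hn : 1 ≤ n) (u : List Bool) (z : ℕ)
    (hz : c n ≤ z) (hz' : z < c (n+1)) (hw : u ++ [false] ++ ones z ++ [false] ∈ qsL a b c) :
    ∃ i k, i < b n ∧ z = c n + i ∧ 1 ≤ k ∧ k ≤ a n ∧
     ((0 < i ∧ ∃ Q, u ++ [false] ++ ones z <:+ Q ++ false :: (ones (c n + i - 1) ++
          wpow (qsB a b c n ++ ones (c n + i)) k)) ∨
      (i = 0 ∧ ∃ Q p, c (n+1) ≤ p ∧ u ++ [false] ++ ones z <:+ Q ++ (ones p ++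
          wpow (qsB a b c n ++ ones (c n)) k))) := by
  obtain ⟨T1, σ1, s, R, Q, hT1, hs, h1, h2, h3⟩ := past a b c hQ n hn u _ z hz hw
  obtain ⟨-, ⟨B2, hB2⟩⟩ := qsB_ends a b c n hn
  have ha := (hQ.1 n hn).1
  have hsz : s = z := by
    by_contra hne
    obtain ⟨d, hd⟩ : ∃ d, s - z = d + 1 := ⟨s - z - 1, by omega⟩
    rw [hd, ones_succ] at h2
    simp at h2
  subst hsz
  rcases h3 with ⟨σ2, h3⟩ | ⟨-, h3⟩
  swap
  · omega
  obtain ⟨j, m, hj, hm, hsj, hσ1⟩ := qstuff_split _ _ _ _ _ _ h3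
  have hsuf : u ++ [false] ++ ones s <:+ qenc (qsB a b c n)
        (qexp (qstuff (a n) (c n) (b n)) T1) ++ (qenc (qsB a b c n) (qstuff (a n) (c n) j) ++
          wpow (qsB a b c n ++ ones (c n + j)) (m+1)) := by
    refine ⟨Q, ?_⟩
    rw [← List.append_assoc, h1, hσ1, qenc_append, qenc_append, wpow_add, wpow_eq, hsj]
    simp [wpow]
  refine ⟨j, m+1, hj, hsj, by omega, by omega, ?_⟩
  rcases Nat.eq_zero_or_pos j with rfl | hj0
  · right
    refine ⟨rfl, ?_⟩
    have e : qstuff (a n) (c n) 0 = [] := rfl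
    rw [e, qenc_nil] at hsuf
    rcases List.eq_nil_or_concat T1 with rfl | ⟨T', t, rfl⟩
    · refine ⟨[], c (n+1), le_rfl, hsuf.trans ?_⟩
      simp [qexp_nil, qenc_nil]
    · refine ⟨?_, t, hT1 t (by simp), hsuf.trans ?_⟩
      · exact qenc (qsB a b c n) (qexp (qstuff (a n) (c n) (b n)) T' ++
          qstuff (a n) (c n) (b n)) ++ qsB a b c n
      · simp [qexp_append, qenc_append, qexp_cons, qexp_nil, qenc_cons, qenc_nil]
  · left
    refine ⟨hj0, ?_⟩
    obtain ⟨i, rfl⟩ : ∃ i, j = i + 1 := ⟨j - 1, by omega⟩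
    obtain ⟨a', ha'⟩ : ∃ a', a n = a' + 1 := ⟨a n - 1, by omega⟩
    refine ⟨?_, hsuf.trans ?_⟩
    · exact qenc (qsB a b c n)
        (qexp (qstuff (a n) (c n) (b n)) T1) ++ qenc (qsB a b c n) (qstuff (a n) (c n) i) ++
         qenc (qsB a b c n) (List.replicate a' (c n + i)) ++ B2
    · have e : c n + (i+1) - 1 = c n + i := by omega
      rw [qstuff_succ, e]
      nth_rw 3 [ha']
      rw [List.replicate_succ', qenc_append, qenc_append]
      simp only [qenc_cons, qenc_nil]
      nth_rw 4 [hB2]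
      simp

theorem pastB (a b c : ℕ → ℕ) (hQ : QShyp a b c) (n : ℕ) (hn : 1 ≤ n) (u : List Bool) (i : ℕ)
    (hi : i < b n)
    (hw : u ++ [false] ++ ones (c n + i) ++ [true] ∈ qsL a b c) :
    (∃ Q r, c n + i < r ∧ r ≤ c n + b n - 1 ∧
      u ++ [false] ++ ones (c n + i) <:+ Q ++ false :: (ones r ++ (qsB a b c n ++ ones (c n + i)))) ∨
    (∃ Q, u ++ [false] ++ ones (c n + i) <:+ Q ++ wpow (qsB a b c n ++ ones (c n + i)) (a n + 1)) := by
  obtain ⟨T1, σ1, s, R, Q, hT1, hs, h1, h2, h3⟩ := past a b c hQ n hn u _ (c n + i) (by omega) hw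
  obtain ⟨-, ⟨B2, hB2⟩⟩ := qsB_ends a b c n hn
  have ha := (hQ.1 n hn).1
  have hcb := hQ.2.2.2.2.2.2 n hn
  have hsz : c n + i < s := by
    by_contra hne
    have : s - (c n + i) = 0 := by omega
    rw [this] at h2
    simp [ones] at h2
  have hsuf : u ++ [false] ++ ones (c n + i) <:+ qenc (qsB a b c n)
        (qexp (qstuff (a n) (c n) (b n)) T1) ++ (qenc (qsB a b c n) σ1 ++
          (qsB a b c n ++ ones (c n + i))) := by
    refine ⟨Q, ?_⟩
    rw [← List.append_assoc, h1, qenc_append]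
    simp
  -- ends with a full block of `c n + j`
  have full : ∀ j, i ≤ j → j < b n → σ1 = qstuff (a n) (c n) (j+1) →
    (∃ Q r, c n + i < r ∧ r ≤ c n + b n - 1 ∧
      u ++ [false] ++ ones (c n + i) <:+ Q ++ false :: (ones r ++ (qsB a b c n ++ ones (c n + i)))) ∨
    (∃ Q, u ++ [false] ++ ones (c n + i) <:+ Q ++ wpow (qsB a b c n ++ ones (c n + i)) (a n + 1)) := by
    intro j hij hjb hσ
    rcases Nat.eq_or_lt_of_le hij with rfl | hlt
    · right
      refine ⟨?_, hsuf.trans ?_⟩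
      · exact qenc (qsB a b c n)
          (qexp (qstuff (a n) (c n) (b n)) T1) ++ qenc (qsB a b c n) (qstuff (a n) (c n) i)
      · rw [hσ, qstuff_succ, qenc_append, wpow_add, wpow_eq]
        simp [wpow]
    · left
      obtain ⟨a', ha'⟩ : ∃ a', a n = a' + 1 := ⟨a n - 1, by omega⟩
      refine ⟨?_, c n + j, by omega, by omega, hsuf.trans ?_⟩
      · exact qenc (qsB a b c n)
          (qexp (qstuff (a n) (c n) (b n)) T1) ++ qenc (qsB a b c n) (qstuff (a n) (c n) j) ++
          qenc (qsB a b c n) (List.replicate a' (c n + j)) ++ B2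
      · rw [hσ, qstuff_succ]
        nth_rw 3 [ha']
        rw [List.replicate_succ', qenc_append, qenc_append]
        simp only [qenc_cons, qenc_nil]
        nth_rw 4 [hB2]
        simp
  rcases h3 with ⟨σ2, h3⟩ | ⟨h3, -⟩
  · obtain ⟨j, m, hj, hm, hsj, hσ1⟩ := qstuff_split _ _ _ _ _ _ h3
    obtain ⟨j, rfl⟩ : ∃ j', j = j' + 1 := ⟨j - 1, by omega⟩
    rcases Nat.eq_zero_or_pos m with rfl | hm0
    · exact full j (by omega) (by omega) (by simpa using hσ1)
    · left
      obtain ⟨m, rfl⟩ : ∃ j', m = j' + 1 := ⟨m - 1, by omega⟩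
      refine ⟨?_, c n + (j + 1), by omega, by omega, hsuf.trans ?_⟩
      · exact qenc (qsB a b c n)
          (qexp (qstuff (a n) (c n) (b n)) T1) ++ qenc (qsB a b c n) (qstuff (a n) (c n) (j+1)) ++
          qenc (qsB a b c n) (List.replicate m (c n + (j+1))) ++ B2
      · rw [hσ1]
        rw [List.replicate_succ', qenc_append, qenc_append]
        simp only [qenc_cons, qenc_nil]
        nth_rw 4 [hB2]
        simp
  · exact full (b n - 1) (by omega) (by omega) (by rw [h3]; congr 1; omega)

theorem ztail_split (w : List Bool) (h : false ∈ w) :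
    ∃ u, w = u ++ [false] ++ ones (ztail w) := by
  induction w using List.reverseRecOn with
  | nil => simp at h
  | append_singleton l x ih =>
    cases x with
    | false => exact ⟨l, by simp [ztail, ones]⟩
    | true =>
      obtain ⟨u, hu⟩ := ih (by simpa using h)
      refine ⟨u, ?_⟩
      have : ztail (l ++ [true]) = ztail l + 1 := by simp [ztail]
      rw [this, ones_add, ← List.append_assoc, ← hu]; rfl

theorem qsh_eq (a b c : ℕ → ℕ) (n : ℕ) : (qsB a b c n).length = qsh a b c n := by
  rcases Nat.eq_zero_or_pos n with rfl | hn
  · rfl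
  induction n, hn using Nat.le_induction with
  | base => rfl
  | succ n hn ih =>
    rw [qsB_succ a b c n hn]
    obtain ⟨m, rfl⟩ : ∃ m, n = m + 1 := ⟨n - 1, by omega⟩
    rw [qsh, ← ih, List.length_append]
    generalize qsB a b c (m+1) = B
    generalize a (m+1) = A
    generalize c (m+1) = C
    have h1 : ∀ k, 2 * (qenc B (qstuff A C k)).length = 2 * (A * k * B.length + A * k * C)
        + A * k * (k - 1) := by
      intro k
      induction k with
      | zero => simp [qstuff, qenc]
      | succ k ih =>
        have : (qenc B (List.replicate A (C + k))).length = A * (B.length + C + k) := by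
          simp [qenc, ones]; left; ring
        rw [qstuff_succ, qenc_append, List.length_append, this, mul_add, ih]
        cases k with
        | zero => simp; ring
        | succ k => simp; ring
    have h2 := h1 (b (m+1))
    have h3 : (A * b (m+1) + 1) * B.length = A * b (m+1) * B.length + B.length := by ring
    rw [h3]
    omega

theorem qs_tail {u v : List Bool} {x y : ℕ} {r s : List Bool}
    (h : r ++ (u ++ false :: ones x) = s ++ (v ++ false :: ones y)) : x = y := by
  have h' := congrArg List.reverse h
  simp only [List.reverse_append, List.reverse_cons, ones, List.reverse_replicate,
    List.append_assoc] at h'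
  have h1 := ones_cmp (z := x) (s := y) (by simpa [ones] using h')
  have h2 := ones_cmp (z := y) (s := x) (by simpa [ones] using h'.symm)
  omega

theorem ones_suffix {p q : ℕ} (h : p ≤ q) : ones p <:+ ones q :=
  ⟨ones (q - p), by rw [← ones_add]; congr 1; omega⟩

theorem suffix_append_right {x y : List Bool} (h : x <:+ y) (z : List Bool) :
    x ++ z <:+ y ++ z := by
  obtain ⟨t, rfl⟩ := h
  exact ⟨t, by simp⟩

theorem sufK_lt (B : List Bool) (p q s k a : ℕ) (h1 : p ≤ s) (hk : k < a) :
    ones p ++ wpow (B ++ ones s) k <:+ ones q ++ wpow (B ++ ones s) a := by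
  have e : a = (a - k - 1) + 1 + k := by omega
  rw [e, wpow_add, wpow_add]
  have e1 : wpow (B ++ ones s) 1 = B ++ ones s := by simp [wpow]
  rw [e1, ← List.append_assoc]
  apply suffix_append_right
  refine (ones_suffix h1).trans ?_
  rw [← List.append_assoc, ← List.append_assoc]
  exact List.suffix_append _ _

theorem sufK_le (B : List Bool) (p q s k a : ℕ) (h1 : p ≤ s) (h2 : p ≤ q) (hk : k ≤ a) :
    ones p ++ wpow (B ++ ones s) k <:+ ones q ++ wpow (B ++ ones s) a := by
  rcases Nat.eq_or_lt_of_le hk with rfl | hk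
  · exact suffix_append_right (ones_suffix h2) _
  · exact sufK_lt B p q s k a h1 hk

theorem wpow_len {α : Type*} (v : List α) (k : ℕ) : (wpow v k).length = k * v.length := by
  simp [wpow]

theorem wpow_one {α : Type*} (v : List α) : wpow v 1 = v := by simp [wpow]

theorem wpow_two_split (B B2 : List Bool) (hB : B = B2 ++ [false]) (s k : ℕ) (hk : 2 ≤ k) :
    ∃ Q, wpow (B ++ ones s) k = Q ++ false :: (ones s ++ (B ++ ones s)) := by
  refine ⟨wpow (B ++ ones s) (k-2) ++ B2, ?_⟩
  obtain ⟨k, rfl⟩ : ∃ j, k = j + 2 := ⟨k - 2, by omega⟩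
  have : k + 2 = k + 1 + 1 := rfl
  rw [this, wpow_add, wpow_add, wpow_one]
  simp
  rw [hB]; simp

theorem main_exists (a b c : ℕ → ℕ) (hQS : QShyp a b c)
    (n : ℕ) (hn : 1 ≤ n) (w : List Bool) (hw : w ∈ Wn a b c n) :
    qsForm1 a b c n w ∨ qsForm2 a b c n w ∨ qsForm3 a b c n w := by
  obtain ⟨⟨-, hw0, hw1⟩, hf, hz, hz'⟩ := hw
  obtain ⟨u, hu⟩ := ztail_split w hf
  have hcpos := (hQS.2.2.2.2.1 n hn).1
  have hapos := (hQS.1 n hn).1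
  have hcb := hQS.2.2.2.2.2.2 n hn
  obtain ⟨-, ⟨B2, hB2⟩⟩ := qsB_ends a b c n hn
  have hh := qsh_eq a b c n
  generalize ztail w = z at hu hz hz'
  rw [hu] at hw0 hw1
  obtain ⟨i, k, hi, hzi, hk1, hka, hA⟩ := pastA a b c hQS n hn u z hz hz' hw0
  subst hzi
  have hB := pastB a b c hQS n hn u i hi hw1
  have hlen : c n + i < w.length := by rw [hu]; simp [ones_len]; omega
  rw [← hu] at hA hB
  have form1 : w <:+ ones (c n + i - 1) ++ wpow (qsB a b c n ++ ones (c n + i)) (a n) →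
      qsForm1 a b c n w := fun h => ⟨i, hi, h, hlen⟩
  -- the past in the first case, when the last two spacers coincide
  have hA2 : 2 ≤ k → ∃ Q, w <:+ Q ++ false :: (ones (c n + i) ++ (qsB a b c n ++ ones (c n + i))) := by
    intro hk
    obtain ⟨Q0, hQ0⟩ := wpow_two_split _ _ hB2 (c n + i) k hk
    rcases hA with ⟨-, Q, h⟩ | ⟨rfl, Q, p, -, h⟩
    · rw [hQ0] at h
      exact ⟨Q ++ false :: (ones (c n + i - 1) ++ Q0), by simpa using h⟩
    · simp only [Nat.add_zero] at *
      rw [hQ0] at h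
      exact ⟨Q ++ (ones p ++ Q0), by simpa using h⟩
  have short3 : i = 0 → w <:+ ones (c n) ++ wpow (qsB a b c n ++ ones (c n)) k →
      qsForm1 a b c n w ∨ qsForm2 a b c n w ∨ qsForm3 a b c n w := by
    rintro rfl hR
    simp only [Nat.add_zero] at *
    rcases Nat.eq_or_lt_of_le hka with rfl | hlt
    · by_cases hl : w.length = (ones (c n) ++ wpow (qsB a b c n ++ ones (c n)) (a n)).length
      · exact Or.inr (Or.inr (hR.eq_of_length hl))
      · left
        apply form1
        refine List.suffix_of_suffix_length_le hR
          (suffix_append_right (ones_suffix (by omega)) _) ?_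
        have := hR.length_le
        simp only [List.length_append, ones_len] at this hl ⊢
        omega
    · left
      apply form1
      exact hR.trans (sufK_lt _ _ _ _ _ _ le_rfl hlt)
  rcases hB with ⟨Q', r, hr1, hr2, hB⟩ | ⟨Q', hB⟩
  · by_cases hk2 : 2 ≤ k
    · left
      obtain ⟨Q, hA2⟩ := hA2 hk2
      have hR : w <:+ ones (c n + i) ++ (qsB a b c n ++ ones (c n + i)) := by
        refine diverge (x := false) (y := true) (by simp) hA2 (Q2 := Q' ++ false :: ones (r - (c n + i) - 1)) ?_
        have e : r = (r - (c n + i) - 1) + 1 + (c n + i) := by omega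
        rw [e, ones_add, ones_add] at hB
        simpa [ones] using hB
      apply form1
      refine hR.trans ?_
      have := sufK_lt (qsB a b c n) (c n + i) (c n + i - 1) (c n + i) 1 (a n) le_rfl (by omega)
      rwa [wpow_one] at this
    · obtain rfl : k = 1 := by omega
      rcases hA with ⟨hi0, Q, hA⟩ | ⟨rfl, Q, p, hp, hA⟩
      · left
        apply form1
        refine List.IsSuffix.trans ?_ (sufK_le _ (c n + i - 1) _ _ 1 _ (by omega) le_rfl hapos)
        refine diverge (x := false) (y := true) (by simp) hA (Q2 := Q' ++ false :: ones (r - (c n + i))) ?_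
        have e : r = (r - (c n + i)) + 1 + (c n + i - 1) := by omega
        rw [e, ones_add, ones_add] at hB
        rw [wpow_one]
        simpa [ones] using hB
      · rw [wpow_one] at hA short3
        have hR : w <:+ ones r ++ (qsB a b c n ++ ones (c n)) := by
          refine diverge (x := true) (y := false) (by simp) (Q1 := Q ++ ones (p - r - 1)) ?_ hB
          have e : p = (p - r - 1) + 1 + r := by omega
          rw [e, ones_add, ones_add] at hA
          simpa [ones] using hA
        by_cases hl : w.length ≤ qsh a b c n + 2 * c n
        · apply short3 rfl
          refine List.suffix_of_suffix_length_le hR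
            (suffix_append_right (ones_suffix (by omega)) _) ?_
          simp only [List.length_append, ones_len, hh]
          omega
        · right; left
          refine ⟨?_, by omega⟩
          rw [List.append_assoc]
          exact hR.trans (suffix_append_right (ones_suffix (by omega)) _)
  · have e : a n + 1 = (a n - k) + 1 + k := by omega
    rw [e, wpow_add, wpow_add, wpow_one] at hB
    rcases hA with ⟨hi0, Q, hA⟩ | ⟨rfl, Q, p, hp, hA⟩
    · left
      apply form1
      refine List.IsSuffix.trans ?_ (sufK_le _ (c n + i - 1) _ _ k _ (by omega) le_rfl hka)
      refine diverge (x := false) (y := true) (by simp) hA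
        (Q2 := Q' ++ wpow (qsB a b c n ++ ones (c n + i)) (a n - k) ++ qsB a b c n) ?_
      have e2 : ones (c n + i) = true :: ones (c n + i - 1) := by
        rw [← ones_succ]; congr 1; omega
      have e3 : Q' ++ wpow (qsB a b c n ++ ones (c n + i)) (a n - k) ++ qsB a b c n ++
          true :: (ones (c n + i - 1) ++ wpow (qsB a b c n ++ ones (c n + i)) k) =
          Q' ++ wpow (qsB a b c n ++ ones (c n + i)) (a n - k) ++ qsB a b c n ++
          (ones (c n + i) ++ wpow (qsB a b c n ++ ones (c n + i)) k) := by
        nth_rw 4 [e2]; rfl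
      rw [e3]
      simpa using hB
    · apply short3 rfl
      simp only [Nat.add_zero] at *
      refine diverge (x := true) (y := false) (by simp) (Q1 := Q ++ ones (p - c n - 1))
        (Q2 := Q' ++ wpow (qsB a b c n ++ ones (c n)) (a n - k) ++ B2) ?_ ?_
      · have e : p = (p - c n - 1) + 1 + c n := by omega
        rw [e, ones_add, ones_add] at hA
        simpa [ones] using hA
      · have e3 : Q' ++ wpow (qsB a b c n ++ ones (c n)) (a n - k) ++ B2 ++
          false :: (ones (c n) ++ wpow (qsB a b c n ++ ones (c n)) k) =
          Q' ++ wpow (qsB a b c n ++ ones (c n)) (a n - k) ++ (B2 ++ [false]) ++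
          (ones (c n) ++ wpow (qsB a b c n ++ ones (c n)) k) := by simp
        rw [e3, ← hB2]
        simpa using hB

/-- Words of form (i) have tail exactly `c n + i`. -/
theorem tail_unique {w X Y : List Bool} {x y : ℕ} (hx : w <:+ X ++ false :: ones x)
    (hy : w <:+ Y ++ false :: ones y) (hlx : x < w.length) (hly : y < w.length) : x = y := by
  have h1 : false :: ones x <:+ w := List.suffix_of_suffix_length_le
    (List.suffix_append _ _) hx (by simp [ones_len]; omega)
  have h2 : false :: ones y <:+ w := List.suffix_of_suffix_length_le
    (List.suffix_append _ _) hy (by simp [ones_len]; omega)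
  obtain ⟨r, hr⟩ := h1
  obtain ⟨s, hs⟩ := h2
  exact qs_tail (u := []) (v := []) (r := r) (s := s) (by simp [hr, hs])

theorem wpow_last (B B2 : List Bool) (hB : B = B2 ++ [false]) (s k : ℕ) (hk : 1 ≤ k) :
    ∃ Q, wpow (B ++ ones s) k = Q ++ false :: ones s := by
  obtain ⟨k, rfl⟩ : ∃ j, k = j + 1 := ⟨k - 1, by omega⟩
  refine ⟨wpow (B ++ ones s) k ++ B2, ?_⟩
  rw [wpow_add, wpow_one]
  nth_rw 2 [hB]
  simp

theorem excl2 (a b c : ℕ → ℕ) (n : ℕ) (hn : 1 ≤ n) (w P : List Bool) (hP : P.length ≤ c n)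
    (h : w <:+ P ++ wpow (qsB a b c n ++ ones (c n)) (a n)) (ha : 1 ≤ a n)
    (h2 : qsForm2 a b c n w) : False := by
  obtain ⟨h2, hl⟩ := h2
  obtain ⟨-, ⟨B2, hB2⟩⟩ := qsB_ends a b c n hn
  have hh := qsh_eq a b c n
  have hl1 := h.length_le
  have hl2 := h2.length_le
  simp only [List.length_append, ones_len, wpow_len, hh] at hl1 hl2
  rcases Nat.eq_or_lt_of_le ha with ha1 | ha2
  · rw [← ha1] at hl1
    omega
  · obtain ⟨Q0, hQ0⟩ := wpow_two_split _ _ hB2 (c n) (a n) ha2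
    rw [hQ0, ← List.append_assoc] at h
    have e : c n + b n - 1 = (b n - 2) + 1 + c n := by omega
    rw [e, ones_add, ones_add] at h2
    have := diverge (x := false) (y := true) (by simp) h (Q2 := ones (b n - 2))
      (by simpa [ones] using h2)
    have := this.length_le
    simp only [List.length_append, ones_len, hh] at this
    omega

/-- Every `w ∈ W n` has exactly one of the three forms (i), (ii), (iii). -/
theorem qs_Wn_trichotomy (a b c : ℕ → ℕ) (hQS : QShyp a b c)
    (n : ℕ) (hn : 1 ≤ n) (w : List Bool) (hw : w ∈ Wn a b c n) :
    (qsForm1 a b c n w ∨ qsForm2 a b c n w ∨ qsForm3 a b c n w) ∧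
    ¬(qsForm1 a b c n w ∧ qsForm2 a b c n w) ∧
    ¬(qsForm1 a b c n w ∧ qsForm3 a b c n w) ∧
    ¬(qsForm2 a b c n w ∧ qsForm3 a b c n w) := by
  have ha := (hQS.1 n hn).1
  have hc := (hQS.2.2.2.2.1 n hn).1
  have hh := qsh_eq a b c n
  obtain ⟨-, ⟨B2, hB2⟩⟩ := qsB_ends a b c n hn
  have hhpos : 1 ≤ qsh a b c n := by rw [← hh, hB2]; simp
  refine ⟨main_exists a b c hQS n hn w hw, ?_, ?_, ?_⟩
  · rintro ⟨⟨i, hi, h1, hl⟩, h2⟩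
    obtain ⟨Q, hQ⟩ := wpow_last _ _ hB2 (c n + i) (a n) ha
    have h2' := h2.1
    rw [hB2] at h2'
    have h1' := h1
    rw [hQ, ← List.append_assoc] at h1'
    have := tail_unique (Y := ones (c n + b n - 1) ++ B2) (y := c n) h1' (by simpa using h2') hl
      (by have := h2.2; omega)
    obtain rfl : i = 0 := by omega
    exact excl2 a b c n hn w _ (by rw [ones_len]; omega) h1 ha h2
  · rintro ⟨⟨i, hi, h1, hl⟩, h3⟩
    obtain ⟨Q, hQ⟩ := wpow_last _ _ hB2 (c n + i) (a n) ha
    obtain ⟨Q', hQ'⟩ := wpow_last _ _ hB2 (c n) (a n) ha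
    have h1' := h1
    rw [hQ, ← List.append_assoc] at h1'
    have h3' : w <:+ (ones (c n) ++ Q') ++ false :: ones (c n) := by
      rw [h3, hQ', List.append_assoc]
    have := tail_unique h1' h3' hl (by omega)
    obtain rfl : i = 0 := by omega
    have hl := h1.length_le
    rw [h3] at hl
    simp only [List.length_append, ones_len, Nat.add_zero] at hl
    omega
  · rintro ⟨h2, h3⟩
    exact excl2 a b c n hn w (ones (c n)) (by rw [ones_len])
      (by rw [h3]) ha h2
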